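/- arXiv:2106.14090 — 3 statements merged into one kernel-verified Lean document; each statement's English description precedes it below -/
import Mathlib

section
/- (Smoothness of the total expected revenue, Lemma 3.7 of Müller et al.) Let f(p) = ∑_{s=1}^S π_s(p) + ∑_{d=1}^D E_d(p), where each π_s(p) = max_{y∈Y_s}{⟨y,p⟩ − c_s(y) − Γ_s‖y − ŷ_s‖₂²} with Γ_s > 0, Y_s ⊆ ℝ^n nonempty closed convex, c_s convex continuous, ŷ_s ∈ Y_s, and each E_d(p) = ln(∑_{j=1}^m (∑_{i∈G_j} e^{(a_{id}−p_i)/μ_j})^{μ_j}) with 0 < μ_j ≤ 1. Then f is differentiable and ∇f is Lipschitz continuous with respect to the Euclidean norm with constant L = ∑_{s=1}^S 1/Γ_s + D/(min_{1≤j≤m} μ_j). -/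
open Finset
open scoped RealInnerProductSpace

/-- The supplier's objective `y ↦ ⟨y,p⟩ − c(y) − Γ‖y − ŷ‖₂²`. -/
noncomputable def revenueObj {n : ℕ} (c : EuclideanSpace ℝ (Fin n) → ℝ) (Γ : ℝ)
    (yhat : EuclideanSpace ℝ (Fin n)) (p y : EuclideanSpace ℝ (Fin n)) : ℝ :=
  ⟪y, p⟫ - c y - Γ * ‖y - yhat‖ ^ 2

/-- The supplier's maximal revenue `π(p) = sup_{y∈Y} { ⟨y,p⟩ − c(y) − Γ‖y − ŷ‖₂² }`. -/
noncomputable def maxRevenue {n : ℕ} (Y : Set (EuclideanSpace ℝ (Fin n)))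
    (c : EuclideanSpace ℝ (Fin n) → ℝ) (Γ : ℝ) (yhat : EuclideanSpace ℝ (Fin n))
    (p : EuclideanSpace ℝ (Fin n)) : ℝ :=
  sSup ((fun y => revenueObj c Γ yhat p y) '' Y)

/-- Sum of exponentiated utilities within group `j`. -/
noncomputable def groupSum {n m : ℕ} (grp : Fin n → Fin m) (a : Fin n → ℝ) (μ : Fin m → ℝ)
    (p : EuclideanSpace ℝ (Fin n)) (j : Fin m) : ℝ :=
  ∑ k ∈ Finset.univ.filter (fun k => grp k = j), Real.exp ((a k - p k) / μ j)

/-- The expected consumer surplus `E(p)`. -/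
noncomputable def surplus {n m : ℕ} (grp : Fin n → Fin m) (a : Fin n → ℝ) (μ : Fin m → ℝ)
    (p : EuclideanSpace ℝ (Fin n)) : ℝ :=
  Real.log (∑ h : Fin m, (groupSum grp a μ p h) ^ (μ h))

/-- The total expected revenue `f(p) = ∑_s π_s(p) + ∑_d E_d(p)`. -/
noncomputable def totalRevenue {n m S D : ℕ} (Y : Fin S → Set (EuclideanSpace ℝ (Fin n)))
    (c : Fin S → EuclideanSpace ℝ (Fin n) → ℝ) (Γ : Fin S → ℝ)
    (yhat : Fin S → EuclideanSpace ℝ (Fin n))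
    (grp : Fin n → Fin m) (a : Fin n → Fin D → ℝ) (μ : Fin m → ℝ)
    (p : EuclideanSpace ℝ (Fin n)) : ℝ :=
  ∑ s : Fin S, maxRevenue (Y s) (c s) (Γ s) (yhat s) p +
    ∑ d : Fin D, surplus grp (fun i => a i d) μ p

section ConvexSmooth

variable {E : Type*} [NormedAddCommGroup E] [InnerProductSpace ℝ E]

/-- `g` is a field of subgradients of `f` whose linearization error is at most `L/2 ‖y - x‖²`. -/
def ConvexSmooth (L : ℝ) (f : E → ℝ) (g : E → E) : Prop :=
  ∀ x y, 0 ≤ f y - f x - ⟪g x, y - x⟫ ∧ f y - f x - ⟪g x, y - x⟫ ≤ L / 2 * ‖y - x‖ ^ 2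

theorem ConvexSmooth.add {L L' : ℝ} {f f' : E → ℝ} {g g' : E → E} (h : ConvexSmooth L f g)
    (h' : ConvexSmooth L' f' g') :
    ConvexSmooth (L + L') (fun x => f x + f' x) (fun x => g x + g' x) := fun x y => by
  have h1 := h x y
  have h2 := h' x y
  simp only [inner_add_left]
  constructor <;> linarith

theorem ConvexSmooth.sum {ι : Type*} {s : Finset ι} {L : ι → ℝ} {f : ι → E → ℝ} {g : ι → E → E}
    (h : ∀ i, ConvexSmooth (L i) (f i) (g i)) :
    ConvexSmooth (∑ i ∈ s, L i) (fun x => ∑ i ∈ s, f i x) (fun x => ∑ i ∈ s, g i x) := fun x y => by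
  simp only [sum_inner, ← Finset.sum_sub_distrib, Finset.sum_div, Finset.sum_mul]
  exact ⟨Finset.sum_nonneg fun i _ => (h i x y).1, Finset.sum_le_sum fun i _ => (h i x y).2⟩

theorem ConvexSmooth.hasGradientAt [CompleteSpace E] {L : ℝ} {f : E → ℝ} {g : E → E}
    (h : ConvexSmooth L f g) (x : E) : HasGradientAt f (g x) x := by
  rw [hasGradientAt_iff_isLittleO]
  refine Asymptotics.IsBigO.trans_isLittleO (g := fun y => ‖y - x‖ ^ 2) ?_ ?_
  · refine Asymptotics.IsBigO.of_bound (L / 2) (Filter.Eventually.of_forall fun y => ?_)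
    rw [Real.norm_of_nonneg (h x y).1, Real.norm_of_nonneg (by positivity)]
    exact (h x y).2
  · exact Asymptotics.isLittleO_pow_sub_sub x one_lt_two

theorem ConvexSmooth.norm_sub_le {L : ℝ} {f : E → ℝ} {g : E → E} (h : ConvexSmooth L f g)
    (x y : E) : ‖g x - g y‖ ≤ L * ‖x - y‖ := by
  rcases eq_or_ne x y with rfl | hxy
  · simp
  rcases eq_or_ne (g x) (g y) with hg | hg
  · have h1 := h x y
    have h2 : 0 < ‖y - x‖ := norm_pos_iff.2 (sub_ne_zero.2 hxy.symm)
    have : 0 ≤ L := by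
      by_contra! hL
      nlinarith [h1.1.trans h1.2, pow_pos h2 2]
    rw [hg, sub_self, norm_zero]
    positivity
  have key : ∀ (u v : E) (t : ℝ), t * ‖g v - g u‖ ^ 2 - L / 2 * t ^ 2 * ‖g v - g u‖ ^ 2 ≤
      f v - f u - ⟪g u, v - u⟫ := fun u v t => by
    have h1 := (h u (v - t • (g v - g u))).1
    have h2 := (h v (v - t • (g v - g u))).2
    have e1 : v - t • (g v - g u) - v = -(t • (g v - g u)) := by abel
    have e2 : v - t • (g v - g u) - u = (v - u) - t • (g v - g u) := by abel
    rw [e1, norm_neg, norm_smul, inner_neg_right, inner_smul_right, mul_pow, Real.norm_eq_abs,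
      sq_abs] at h2
    rw [e2, inner_sub_right, inner_smul_right] at h1
    have h3 : ‖g v - g u‖ ^ 2 = ⟪g v, g v - g u⟫ - ⟪g u, g v - g u⟫ := by
      rw [← inner_sub_left, real_inner_self_eq_norm_sq]
    have h4 : t * ‖g v - g u‖ ^ 2 = t * ⟪g v, g v - g u⟫ - t * ⟪g u, g v - g u⟫ := by
      rw [h3, mul_sub]
    linarith
  have hd : 0 < ‖x - y‖ := norm_pos_iff.2 (sub_ne_zero.2 hxy)
  have hΔ : 0 < ‖g x - g y‖ := norm_pos_iff.2 (sub_ne_zero.2 hg)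
  set t := ‖x - y‖ / ‖g x - g y‖ with ht
  have htΔ : t * ‖g x - g y‖ = ‖x - y‖ := by rw [ht]; field_simp
  have h1 := key x y t
  have h2 := key y x t
  rw [norm_sub_rev (g y) (g x)] at h1
  have h3 : -⟪g x, y - x⟫ - ⟪g y, x - y⟫ = ⟪g x - g y, x - y⟫ := by
    rw [← neg_sub x y, inner_neg_right, inner_sub_left]; ring
  have h4 := real_inner_le_norm (g x - g y) (x - y)
  have h5 : t * ‖g x - g y‖ ^ 2 = ‖x - y‖ * ‖g x - g y‖ := by rw [← htΔ]; ring
  have h6 : L / 2 * t ^ 2 * ‖g x - g y‖ ^ 2 = L / 2 * ‖x - y‖ ^ 2 := by rw [← htΔ]; ring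
  rw [h5, h6] at h1 h2
  refine le_of_mul_le_mul_right ?_ hd
  nlinarith

end ConvexSmooth

section Supplier

variable {n : ℕ} {Y : Set (EuclideanSpace ℝ (Fin n))} {c : EuclideanSpace ℝ (Fin n) → ℝ} {Γ : ℝ}
  {yhat : EuclideanSpace ℝ (Fin n)}

theorem exists_isMaxOn_revenueObj (hY : IsClosed Y) (hc : ConvexOn ℝ Set.univ c)
    (hcc : Continuous c) (hΓ : 0 < Γ) (hy : yhat ∈ Y) (p : EuclideanSpace ℝ (Fin n)) :
    ∃ y ∈ Y, IsMaxOn (revenueObj c Γ yhat p) Y y := by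
  obtain ⟨K, hK⟩ := (isCompact_closedBall yhat 1).bddBelow_image hcc.continuousOn
  have hK' : ∀ u, ‖u - yhat‖ ≤ 1 → K ≤ c u := fun u hu =>
    hK ⟨u, by simpa [dist_eq_norm] using hu, rfl⟩
  have hcont : Continuous (revenueObj c Γ yhat p) := by
    unfold revenueObj
    fun_prop
  obtain ⟨R, hR1, hR⟩ : ∃ R : ℝ, 1 ≤ R ∧ (‖p‖ + (c yhat - K)) / Γ ≤ R :=
    ⟨max 1 _, le_max_left _ _, le_max_right _ _⟩
  rw [div_le_iff₀ hΓ] at hR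
  obtain ⟨y, hyY, hmax⟩ := ((isCompact_closedBall yhat R).inter_left hY).exists_isMaxOn
    ⟨yhat, hy, Metric.mem_closedBall_self (by linarith)⟩ hcont.continuousOn
  refine ⟨y, hyY.1, fun z hz => ?_⟩
  by_cases hzR : ‖z - yhat‖ ≤ R
  · exact hmax ⟨hz, by simpa [dist_eq_norm] using hzR⟩
  have hyh : revenueObj c Γ yhat p yhat ≤ revenueObj c Γ yhat p y :=
    hmax ⟨hy, Metric.mem_closedBall_self (by linarith)⟩
  refine le_trans ?_ hyh
  set r := ‖z - yhat‖ with hr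
  have hr1 : 1 < r := by linarith
  have hr0 : 0 < r := by linarith
  have hconv := hc.2 (Set.mem_univ yhat) (Set.mem_univ z)
    (show 0 ≤ 1 - 1 / r by rw [sub_nonneg, div_le_one hr0]; exact hr1.le)
    (show 0 ≤ 1 / r by positivity) (by ring)
  have hu := hK' ((1 - 1 / r) • yhat + (1 / r) • z) (by
    have : (1 - 1 / r) • yhat + (1 / r) • z - yhat = (1 / r) • (z - yhat) := by module
    rw [this, norm_smul, ← hr, Real.norm_of_nonneg (by positivity)]
    field_simp; rfl)
  have h1 : K ≤ (1 - 1 / r) * c yhat + 1 / r * c z := hu.trans hconv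
  have h2 : r * K ≤ (r - 1) * c yhat + c z := by
    calc r * K ≤ r * ((1 - 1 / r) * c yhat + 1 / r * c z) := by gcongr
      _ = _ := by field_simp
  have h3 : ⟪z, p⟫ - ⟪yhat, p⟫ ≤ r * ‖p‖ := by
    rw [← inner_sub_left]; exact real_inner_le_norm _ _
  have h4 : r * (‖p‖ + (c yhat - K)) ≤ r * (r * Γ) := by
    gcongr
    nlinarith
  simp only [revenueObj, sub_self, norm_zero, ← hr]
  nlinarith

theorem revenueObj_add_le_of_isMaxOn (hY : Convex ℝ Y) (hc : ConvexOn ℝ Set.univ c)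
    {p y z : EuclideanSpace ℝ (Fin n)} (hy : y ∈ Y) (hz : z ∈ Y)
    (hmax : IsMaxOn (revenueObj c Γ yhat p) Y y) :
    revenueObj c Γ yhat p z + Γ / 2 * ‖z - y‖ ^ 2 ≤ revenueObj c Γ yhat p y := by
  have hw := hmax (hY hy hz (a := 1 / 2) (b := 1 / 2) (by norm_num) (by norm_num) (by norm_num))
  have hcw := hc.2 (Set.mem_univ y) (Set.mem_univ z)
    (show (0 : ℝ) ≤ 1 / 2 by norm_num) (show (0 : ℝ) ≤ 1 / 2 by norm_num) (by norm_num)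
  simp only [Set.mem_ofPred_eq, revenueObj, inner_add_left, inner_smul_left, smul_eq_mul,
    conj_trivial] at hw hcw ⊢
  have e1 : (1 / 2 : ℝ) • y + (1 / 2 : ℝ) • z - yhat = (1 / 2 : ℝ) • ((y - yhat) + (z - yhat)) := by
    module
  have e2 : z - y = (z - yhat) - (y - yhat) := by abel
  have e3 : ‖(1 / 2 : ℝ) • ((y - yhat) + (z - yhat))‖ ^ 2 =
      1 / 4 * ‖(y - yhat) + (z - yhat)‖ ^ 2 := by
    rw [norm_smul, mul_pow, Real.norm_of_nonneg (by norm_num)]; norm_num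
  rw [e1, e3, norm_add_sq_real] at hw
  rw [e2, norm_sub_sq_real (z - yhat) (y - yhat), real_inner_comm (y - yhat) (z - yhat)]
  linarith

theorem exists_convexSmooth_maxRevenue (hY : IsClosed Y) (hYc : Convex ℝ Y)
    (hc : ConvexOn ℝ Set.univ c) (hcc : Continuous c) (hΓ : 0 < Γ) (hy : yhat ∈ Y) :
    ∃ g, ConvexSmooth (1 / Γ) (maxRevenue Y c Γ yhat) g := by
  choose g hgY hg using exists_isMaxOn_revenueObj hY hc hcc hΓ hy
  have hval : ∀ p, maxRevenue Y c Γ yhat p = revenueObj c Γ yhat p (g p) := fun p =>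
    IsGreatest.csSup_eq ⟨⟨g p, hgY p, rfl⟩, by rintro _ ⟨z, hz, rfl⟩; exact hg p hz⟩
  refine ⟨g, fun p q => ?_⟩
  have hshift : ∀ y, revenueObj c Γ yhat q y = revenueObj c Γ yhat p y + ⟪y, q - p⟫ := fun y => by
    simp only [revenueObj, inner_sub_right]; ring
  rw [hval, hval]
  constructor
  · have h1 : revenueObj c Γ yhat q (g p) ≤ revenueObj c Γ yhat q (g q) := hg q (hgY p)
    rw [hshift (g p)] at h1
    linarith
  · have h1 := revenueObj_add_le_of_isMaxOn hYc hc (hgY p) (hgY q) (hg p)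
    have h2 := real_inner_le_norm (g q - g p) (q - p)
    rw [inner_sub_left] at h2
    rw [hshift (g q)]
    have h3 : ‖g q - g p‖ * ‖q - p‖ ≤ Γ / 2 * ‖g q - g p‖ ^ 2 + 1 / Γ / 2 * ‖q - p‖ ^ 2 := by
      have : 0 ≤ 1 / (2 * Γ) * (Γ * ‖g q - g p‖ - ‖q - p‖) ^ 2 := by positivity
      have e : 1 / (2 * Γ) * (Γ * ‖g q - g p‖ - ‖q - p‖) ^ 2 = Γ / 2 * ‖g q - g p‖ ^ 2 +
          1 / Γ / 2 * ‖q - p‖ ^ 2 - ‖g q - g p‖ * ‖q - p‖ := by field_simp; ring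
      linarith
    linarith

end Supplier

section Surplus

theorem taylor_bounds_of_hasDerivAt {φ ψ χ : ℝ → ℝ} {K : ℝ} (hφ : ∀ t, HasDerivAt φ (ψ t) t)
    (hψ : ∀ t, HasDerivAt ψ (χ t) t) (h0 : ∀ t, 0 ≤ χ t) (hK : ∀ t, χ t ≤ K) :
    0 ≤ φ 1 - φ 0 - ψ 0 ∧ φ 1 - φ 0 - ψ 0 ≤ K / 2 := by
  have hmono : Monotone ψ := monotone_of_hasDerivAt_nonneg hψ h0
  have hmono' : Monotone fun t => K * t - ψ t := by
    refine monotone_of_hasDerivAt_nonneg (f' := fun t => K - χ t) (fun t => ?_)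
      fun t => sub_nonneg.2 (hK t)
    simpa using ((hasDerivAt_id t).const_mul K).fun_sub (hψ t)
  have key : ∀ {F F' : ℝ → ℝ}, (∀ t, HasDerivAt F (F' t) t) → (∀ t, 0 ≤ t → 0 ≤ F' t) →
      F 0 ≤ F 1 := fun {F F'} hF hF' => by
    refine monotoneOn_of_hasDerivWithinAt_nonneg (f' := F') (convex_Ici (0 : ℝ))
      (fun t _ => (hF t).continuousAt.continuousWithinAt) (fun t _ => (hF t).hasDerivWithinAt)
      (fun t ht => hF' t ?_) (by simp) (by simp) zero_le_one
    rw [interior_Ici] at ht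
    exact le_of_lt ht
  constructor
  · have := key (F := fun t => φ t - ψ 0 * t) (F' := fun t => ψ t - ψ 0)
      (fun t => by simpa using (hφ t).fun_sub ((hasDerivAt_id t).const_mul (ψ 0)))
      (fun t ht => sub_nonneg.2 (hmono ht))
    simp only [mul_zero, mul_one] at this
    linarith
  · have := key (F := fun t => ψ 0 * t + K / 2 * t ^ 2 - φ t)
      (F' := fun t => ψ 0 + K * t - ψ t)
      (fun t => by
        have h := (((hasDerivAt_id t).const_mul (ψ 0)).add
          ((hasDerivAt_pow 2 t).const_mul (K / 2))).sub (hφ t)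
        refine h.congr_deriv ?_
        simp only [Nat.cast_ofNat]; ring)
      (fun t ht => by have := hmono' ht; simp only at this; linarith)
    simp only [mul_zero, mul_one] at this
    linarith

theorem sq_sum_mul_le_sum_mul_sum {ι : Type*} (s : Finset ι) {w : ι → ℝ} (hw : ∀ i ∈ s, 0 ≤ w i)
    (x : ι → ℝ) : (∑ i ∈ s, x i * w i) ^ 2 ≤ (∑ i ∈ s, w i) * ∑ i ∈ s, x i ^ 2 * w i :=
  Finset.sum_sq_le_sum_mul_sum_of_sq_le_mul s hw
    (fun i hi => mul_nonneg (sq_nonneg _) (hw i hi)) (fun i _ => le_of_eq (by ring))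

/-- Second-order Taylor bounds for `t ↦ log ∑ⱼ sⱼ(t)^μⱼ`, where `Nⱼ / μⱼ` is the derivative of `sⱼ`
and `Rⱼ / μⱼ` that of `Nⱼ`. -/
theorem log_sum_rpow_taylor_bounds {ι : Type*} [Fintype ι] [Nonempty ι] {μ : ι → ℝ} {μ₀ V : ℝ}
    {s N R : ι → ℝ → ℝ} (hμ₀ : 0 < μ₀) (hμ : ∀ j, μ₀ ≤ μ j) (hμ1 : ∀ j, μ j ≤ 1)
    (hs : ∀ j t, 0 < s j t)
    (hsd : ∀ j t, HasDerivAt (s j) (N j t / μ j) t)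
    (hNd : ∀ j t, HasDerivAt (N j) (R j t / μ j) t)
    (hNR : ∀ j t, N j t ^ 2 ≤ s j t * R j t) (hRV : ∀ j t, R j t ≤ V * s j t) :
    let φ := fun t => Real.log (∑ j, s j t ^ μ j)
    let ψ := (∑ j, s j 0 ^ (μ j - 1) * N j 0) / ∑ j, s j 0 ^ μ j
    0 ≤ φ 1 - φ 0 - ψ ∧ φ 1 - φ 0 - ψ ≤ (V / μ₀) / 2 := by
  have hμp : ∀ j, 0 < μ j := fun j => hμ₀.trans_le (hμ j)
  have hw : ∀ j t, 0 < s j t ^ μ j := fun j t => Real.rpow_pos_of_pos (hs j t) _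
  have hT : ∀ t, 0 < ∑ j, s j t ^ μ j := fun t =>
    Finset.sum_pos (fun j _ => hw j t) Finset.univ_nonempty
  have hTd : ∀ t, HasDerivAt (fun t => ∑ j, s j t ^ μ j) (∑ j, s j t ^ (μ j - 1) * N j t) t := by
    refine fun t => HasDerivAt.fun_sum fun j _ => ?_
    refine ((hsd j t).rpow_const (p := μ j) (Or.inl (hs j t).ne')).congr_deriv ?_
    have := (hμp j).ne'
    field_simp
  have hAd : ∀ t, HasDerivAt (fun t => ∑ j, s j t ^ (μ j - 1) * N j t)
      (∑ j, ((N j t / s j t) ^ 2 + (R j t / s j t - (N j t / s j t) ^ 2) / μ j) * s j t ^ μ j) t := by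
    refine fun t => HasDerivAt.fun_sum fun j _ => ?_
    refine (((hsd j t).rpow_const (p := μ j - 1) (Or.inl (hs j t).ne')).mul
      (hNd j t)).congr_deriv ?_
    have h1 := (hμp j).ne'
    have h2 := (hs j t).ne'
    rw [Real.rpow_sub_one h2, Real.rpow_sub_one h2]
    field_simp
    ring
  refine taylor_bounds_of_hasDerivAt (fun t => (hTd t).log (hT t).ne')
    (fun t => (hAd t).div (hTd t) (hT t).ne') (fun t => ?_) (fun t => ?_)
  all_goals
    have hx : ∀ j, (N j t / s j t) ^ 2 ≤ R j t / s j t := fun j => by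
      have := hs j t
      rw [div_pow, div_le_div_iff₀ (by positivity) this]
      nlinarith [hNR j t]
    have hA : ∑ j, s j t ^ (μ j - 1) * N j t = ∑ j, N j t / s j t * s j t ^ μ j :=
      Finset.sum_congr rfl fun j _ => by
        rw [Real.rpow_sub_one (hs j t).ne']; ring
  · refine div_nonneg ?_ (sq_nonneg _)
    rw [sub_nonneg, ← sq, hA, mul_comm]
    refine (sq_sum_mul_le_sum_mul_sum _ (fun j _ => (hw j t).le) _).trans ?_
    refine mul_le_mul_of_nonneg_left (Finset.sum_le_sum fun j _ => ?_) (hT t).le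
    refine mul_le_mul_of_nonneg_right ?_ (hw j t).le
    have := div_nonneg (sub_nonneg.2 (hx j)) (hμp j).le
    linarith
  · have hB : ∑ j, ((N j t / s j t) ^ 2 + (R j t / s j t - (N j t / s j t) ^ 2) / μ j) * s j t ^ μ j ≤
        V / μ₀ * ∑ j, s j t ^ μ j := by
      rw [Finset.mul_sum]
      refine Finset.sum_le_sum fun j _ => mul_le_mul_of_nonneg_right ?_ (hw j t).le
      have h1 : (N j t / s j t) ^ 2 ≤ (N j t / s j t) ^ 2 / μ j :=
        le_div_self (sq_nonneg _) (hμp j) (hμ1 j)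
      have h2 : R j t / s j t ≤ V := (div_le_iff₀ (hs j t)).2 (hRV j t)
      have h3 : R j t / s j t / μ j ≤ V / μ₀ :=
        div_le_div₀ (((sq_nonneg _).trans (hx j)).trans h2) h2 hμ₀ (hμ j)
      rw [sub_div]
      linarith
    rw [div_le_iff₀ (by have := hT t; positivity)]
    nlinarith [mul_le_mul_of_nonneg_right hB (hT t).le,
      sq_nonneg (∑ j, s j t ^ (μ j - 1) * N j t)]

theorem exists_convexSmooth_surplus {n m : ℕ} [Nonempty (Fin m)] {grp : Fin n → Fin m}
    (hgrp : Function.Surjective grp) (a : Fin n → ℝ) {μ : Fin m → ℝ} {μ₀ : ℝ} (hμ₀ : 0 < μ₀)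
    (hμ : ∀ j, μ₀ ≤ μ j) (hμ1 : ∀ j, μ j ≤ 1) :
    ∃ g, ConvexSmooth (1 / μ₀) (surplus grp a μ) g := by
  refine ⟨fun p => WithLp.toLp 2 fun k => -(groupSum grp a μ p (grp k) ^ (μ (grp k) - 1) *
    Real.exp ((a k - p k) / μ (grp k))) / ∑ j, groupSum grp a μ p j ^ μ j, fun p q => ?_⟩
  set v := q - p with hv
  have hd : ∀ (w : Fin n → ℝ) (j : Fin m) (t : ℝ), HasDerivAt
      (fun t : ℝ => ∑ k with grp k = j, w k * Real.exp ((a k - (p + t • v) k) / μ j))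
      ((∑ k with grp k = j, (w k * -v k) * Real.exp ((a k - (p + t • v) k) / μ j)) / μ j) t := by
    intro w j t
    rw [Finset.sum_div]
    refine HasDerivAt.fun_sum fun k _ => ?_
    have h1 : HasDerivAt (fun t : ℝ => (a k - (p + t • v) k) / μ j) (-v k / μ j) t := by
      have := ((((hasDerivAt_id t).mul_const (v k)).const_add (p k)).const_sub (a k)).div_const (μ j)
      simpa using this
    exact (h1.exp.const_mul (w k)).congr_deriv (by ring)
  have hv2 : ∀ k, v k ^ 2 ≤ ‖v‖ ^ 2 := fun k => by
    rw [EuclideanSpace.real_norm_sq_eq]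
    exact Finset.single_le_sum (f := fun i => v i ^ 2) (fun i _ => sq_nonneg _) (Finset.mem_univ k)
  have key := log_sum_rpow_taylor_bounds (V := ‖v‖ ^ 2) hμ₀ hμ hμ1
    (s := fun j t => groupSum grp a μ (p + t • v) j)
    (N := fun j t => ∑ k with grp k = j, -v k * Real.exp ((a k - (p + t • v) k) / μ j))
    (R := fun j t => ∑ k with grp k = j, (-v k) ^ 2 * Real.exp ((a k - (p + t • v) k) / μ j))
    (fun j t => Finset.sum_pos (fun k _ => Real.exp_pos _)
      (by obtain ⟨k, hk⟩ := hgrp j; exact ⟨k, by simp [hk]⟩))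
    (fun j t => by simpa [groupSum] using hd (fun _ => 1) j t)
    (fun j t => by simpa only [sq] using hd (fun k => -v k) j t)
    (fun j t => sq_sum_mul_le_sum_mul_sum _ (fun k _ => (Real.exp_pos _).le) _)
    (fun j t => by
      rw [groupSum, Finset.mul_sum]
      refine Finset.sum_le_sum fun k _ => mul_le_mul_of_nonneg_right ?_ (Real.exp_pos _).le
      rw [neg_sq]
      exact hv2 k)
  have hg : ⟪(WithLp.toLp 2 fun k => -(groupSum grp a μ p (grp k) ^ (μ (grp k) - 1) *
      Real.exp ((a k - p k) / μ (grp k))) / ∑ j, groupSum grp a μ p j ^ μ j :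
      EuclideanSpace ℝ (Fin n)), v⟫ =
      (∑ j, groupSum grp a μ p j ^ (μ j - 1) *
        ∑ k with grp k = j, -v k * Real.exp ((a k - p k) / μ j)) /
        ∑ j, groupSum grp a μ p j ^ μ j := by
    rw [PiLp.inner_apply, ← Finset.sum_fiberwise _ grp, Finset.sum_div]
    refine Finset.sum_congr rfl fun j _ => ?_
    rw [Finset.mul_sum, Finset.sum_div]
    refine Finset.sum_congr rfl fun k hk => ?_
    rw [← (Finset.mem_filter.1 hk).2]
    simp only [RCLike.inner_apply, conj_trivial]
    ring
  have hq : p + v = q := by rw [hv]; abel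
  simp only [zero_smul, add_zero, one_smul, hq] at key
  rw [hg]
  simp only [surplus]
  exact ⟨key.1, key.2.trans_eq (by ring)⟩

end Surplus

/-- Smoothness of the total expected revenue (Lemma 3.7 of Müller et al.): `f` is differentiable
and `∇f` is Lipschitz continuous w.r.t. the Euclidean norm with constant
`L = ∑_s 1/Γ_s + D/(min_j μ_j)`. -/
theorem totalRevenue_smooth {n m S D : ℕ} (hm : 0 < m)
    (Y : Fin S → Set (EuclideanSpace ℝ (Fin n)))
    (hYne : ∀ s, (Y s).Nonempty) (hYclosed : ∀ s, IsClosed (Y s))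
    (hYconvex : ∀ s, Convex ℝ (Y s))
    (c : Fin S → EuclideanSpace ℝ (Fin n) → ℝ)
    (hc : ∀ s, ConvexOn ℝ Set.univ (c s)) (hccont : ∀ s, Continuous (c s))
    (Γ : Fin S → ℝ) (hΓ : ∀ s, 0 < Γ s)
    (yhat : Fin S → EuclideanSpace ℝ (Fin n)) (hyhat : ∀ s, yhat s ∈ Y s)
    (grp : Fin n → Fin m) (hgrp : Function.Surjective grp)
    (a : Fin n → Fin D → ℝ)
    (μ : Fin m → ℝ) (hμ0 : ∀ j, 0 < μ j) (hμ1 : ∀ j, μ j ≤ 1) :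
    Differentiable ℝ (totalRevenue Y c Γ yhat grp a μ) ∧
    ∀ p q : EuclideanSpace ℝ (Fin n),
      ‖gradient (totalRevenue Y c Γ yhat grp a μ) p -
          gradient (totalRevenue Y c Γ yhat grp a μ) q‖ ≤
        (∑ s : Fin S, 1 / Γ s +
          (D : ℝ) / Finset.univ.inf' ⟨⟨0, hm⟩, Finset.mem_univ _⟩ μ) * ‖p - q‖ := by
  set μ₀ := Finset.univ.inf' ⟨⟨0, hm⟩, Finset.mem_univ _⟩ μ with hμ₀
  have : Nonempty (Fin m) := ⟨⟨0, hm⟩⟩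
  have hμ₀pos : 0 < μ₀ := (Finset.lt_inf'_iff _).2 fun j _ => hμ0 j
  choose g hg using fun s => exists_convexSmooth_maxRevenue (hYclosed s) (hYconvex s) (hc s)
    (hccont s) (hΓ s) (hyhat s)
  choose g' hg' using fun d => exists_convexSmooth_surplus hgrp (fun i => a i d) hμ₀pos
    (fun j => Finset.inf'_le μ (Finset.mem_univ j)) hμ1
  have key : ConvexSmooth (∑ s : Fin S, 1 / Γ s + (D : ℝ) / μ₀) (totalRevenue Y c Γ yhat grp a μ)
      (fun p => ∑ s, g s p + ∑ d, g' d p) := by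
    have h := (ConvexSmooth.sum (s := Finset.univ) hg).add (ConvexSmooth.sum (s := Finset.univ) hg')
    rw [Finset.sum_const, Finset.card_univ, Fintype.card_fin, nsmul_eq_mul, mul_one_div] at h
    exact h
  refine ⟨fun p => (key.hasGradientAt p).differentiableAt, fun p q => ?_⟩
  rw [(key.hasGradientAt p).gradient, (key.hasGradientAt q).gradient]
  exact key.norm_sub_le p q
end

section
/- Smoothness of the smoothed total revenue: let f_η(p) = ∑_{s=1}^S π_{s,η}(p) + ∑_{d=1}^D E_d(p), where π_{s,η}(p) = max_{y∈Y_s}{⟨y,p⟩ − c_s(y) − η‖y − y₀‖₂²} with η > 0, Y_s ⊆ ℝ^n nonempty closed convex, c_s convex continuous, and E_d(p) = ln(∑_{j=1}^m (∑_{i∈G_j} e^{(a_{id}−p_i)/μ_j})^{μ_j}) with 0 < μ_j ≤ 1. Then f_η is differentiable and ∇f_η is Lipschitz continuous with respect to the Euclidean norm with constant L = S/η + D/(min_j μ_j); in particular, for η = ε/(2R²) with ε, R > 0, L = 2SR²/ε + D/(min_j μ_j). -/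
open Finset
open scoped RealInnerProductSpace

/-- The Nesterov smoothing `π_{s,η}(p) = max_{y∈Y_s}{⟨y,p⟩ − c_s(y) − η‖y − y₀‖₂²}`. -/
noncomputable def maxRevenueSmoothed {n : ℕ} (Y : Set (EuclideanSpace ℝ (Fin n)))
    (c : EuclideanSpace ℝ (Fin n) → ℝ) (η : ℝ) (y0 : EuclideanSpace ℝ (Fin n))
    (p : EuclideanSpace ℝ (Fin n)) : ℝ :=
  sSup ((fun y => ⟪y, p⟫ - c y - η * ‖y - y0‖ ^ 2) '' Y)

/-- The smoothed total expected revenue `f_η(p) = ∑_s π_{s,η}(p) + ∑_d E_d(p)`. -/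
noncomputable def totalRevenueSmoothed {n m S D : ℕ}
    (Y : Fin S → Set (EuclideanSpace ℝ (Fin n)))
    (c : Fin S → EuclideanSpace ℝ (Fin n) → ℝ) (η : ℝ)
    (y0 : EuclideanSpace ℝ (Fin n))
    (grp : Fin n → Fin m) (a : Fin n → Fin D → ℝ) (μ : Fin m → ℝ)
    (p : EuclideanSpace ℝ (Fin n)) : ℝ :=
  ∑ s : Fin S, maxRevenueSmoothed (Y s) (c s) η y0 p +
    ∑ d : Fin D, surplus grp (fun i => a i d) μ p

/-- The smoothed profit of a supplier with a continuous convex cost has a maximizer. -/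
theorem exists_isMaxOn_smoothedProfit {E : Type*} [NormedAddCommGroup E] [InnerProductSpace ℝ E]
    [FiniteDimensional ℝ E] {Y : Set E} (hne : Y.Nonempty) (hclosed : IsClosed Y)
    {c : E → ℝ} (hc : ConvexOn ℝ Set.univ c) (hcont : Continuous c) {η : ℝ} (hη : 0 < η)
    (y0 p : E) :
    ∃ y ∈ Y, IsMaxOn (fun y => ⟪y, p⟫ - c y - η * ‖y - y0‖ ^ 2) Y y := by
  obtain ⟨x₀, hx₀⟩ := hne
  obtain ⟨l, b, hl, -⟩ := ConvexOn.exists_affine_le_of_lt (𝕜 := ℝ) (Set.mem_univ y0)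
    (sub_one_lt (c y0)) isClosed_univ (hcont.lowerSemicontinuous.lowerSemicontinuousOn _) hc
  have hlc (y : E) : l y + b ≤ c y := by simpa using hl ⟨y, Set.mem_univ y⟩
  refine ContinuousOn.exists_isMaxOn' (by fun_prop) hclosed hx₀ ?_
  set φ : E →L[ℝ] ℝ := innerSL ℝ p - l with hφ
  set K : ℝ := |φ y0 - b - (⟪x₀, p⟫ - c x₀ - η * ‖x₀ - y0‖ ^ 2)| with hK
  have hK0 : 0 ≤ K := abs_nonneg _
  have hKle := le_abs_self (φ y0 - b - (⟪x₀, p⟫ - c x₀ - η * ‖x₀ - y0‖ ^ 2))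
  refine Filter.Eventually.filter_mono inf_le_left ?_
  have hlim := tendsto_dist_right_cocompact_atTop y0
  filter_upwards [hlim.eventually_ge_atTop 1, hlim.eventually_ge_atTop ((‖φ‖ + K) / η)]
    with y h₁ h₂
  rw [dist_eq_norm] at h₁ h₂
  rw [div_le_iff₀ hη] at h₂
  have hφy : φ (y - y0) ≤ ‖φ‖ * ‖y - y0‖ := (le_abs_self _).trans (φ.le_opNorm _)
  have hsub : φ (y - y0) = ⟪y, p⟫ - l y - φ y0 := by
    rw [map_sub]; simp [hφ, real_inner_comm]
  nlinarith [hlc y, mul_le_mul_of_nonneg_right h₂ (norm_nonneg (y - y0)),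
    mul_le_mul_of_nonneg_left h₁ hK0]

/-- A maximizer of the smoothed profit beats every feasible point by a quadratic margin. -/
theorem smoothedProfit_add_le_of_isMaxOn {E : Type*} [NormedAddCommGroup E]
    [InnerProductSpace ℝ E] {Y : Set E} (hconvex : Convex ℝ Y) {c : E → ℝ}
    (hc : ConvexOn ℝ Set.univ c) {η : ℝ} {y0 p y z : E} (hy : y ∈ Y) (hz : z ∈ Y)
    (hmax : IsMaxOn (fun y => ⟪y, p⟫ - c y - η * ‖y - y0‖ ^ 2) Y y) :
    ⟪z, p⟫ - c z - η * ‖z - y0‖ ^ 2 + η / 2 * ‖y - z‖ ^ 2 ≤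
      ⟪y, p⟫ - c y - η * ‖y - y0‖ ^ 2 := by
  have hmid := hmax (hconvex hy hz (by norm_num : (0 : ℝ) ≤ 1 / 2)
    (by norm_num : (0 : ℝ) ≤ 1 / 2) (by norm_num))
  have hcmid := hc.2 (Set.mem_univ y) (Set.mem_univ z) (by norm_num : (0 : ℝ) ≤ 1 / 2)
    (by norm_num : (0 : ℝ) ≤ 1 / 2) (by norm_num)
  have hnorm : ‖(1 / 2 : ℝ) • y + (1 / 2 : ℝ) • z - y0‖ ^ 2 =
      ‖y - y0‖ ^ 2 / 2 + ‖z - y0‖ ^ 2 / 2 - ‖y - z‖ ^ 2 / 4 := by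
    have h₁ : (1 / 2 : ℝ) • y + (1 / 2 : ℝ) • z - y0 =
        (1 / 2 : ℝ) • ((y - y0) + (z - y0)) := by module
    have h₂ : y - z = (y - y0) - (z - y0) := by abel
    rw [h₁, h₂, norm_smul, mul_pow, norm_add_sq_real,
      norm_sub_sq_real (y - y0)]
    norm_num
    ring
  simp only [Set.mem_ofPred_eq, inner_add_left, real_inner_smul_left, hnorm,
    smul_eq_mul] at hmid hcmid
  linarith

/-- The smoothed maximal revenue is differentiable with `1 / η`-Lipschitz gradient. -/
theorem exists_hasGradientAt_maxRevenueSmoothed {n : ℕ} {Y : Set (EuclideanSpace ℝ (Fin n))}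
    (hne : Y.Nonempty) (hclosed : IsClosed Y) (hconvex : Convex ℝ Y)
    {c : EuclideanSpace ℝ (Fin n) → ℝ} (hc : ConvexOn ℝ Set.univ c) (hcont : Continuous c)
    {η : ℝ} (hη : 0 < η) (y0 : EuclideanSpace ℝ (Fin n)) :
    ∃ g : EuclideanSpace ℝ (Fin n) → EuclideanSpace ℝ (Fin n),
      (∀ p, HasGradientAt (maxRevenueSmoothed Y c η y0) (g p) p) ∧
      ∀ p q, ‖g p - g q‖ ≤ 1 / η * ‖p - q‖ := by
  choose g hgY hgmax using exists_isMaxOn_smoothedProfit hne hclosed hc hcont hη y0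
  have hval (p) : maxRevenueSmoothed Y c η y0 p =
      ⟪g p, p⟫ - c (g p) - η * ‖g p - y0‖ ^ 2 :=
    IsGreatest.csSup_eq ⟨Set.mem_image_of_mem _ (hgY p), by
      rintro _ ⟨y, hy, rfl⟩
      exact hgmax p hy⟩
  have hlip (p q) : ‖g p - g q‖ ≤ 1 / η * ‖p - q‖ := by
    have h₁ := smoothedProfit_add_le_of_isMaxOn hconvex hc (hgY p) (hgY q) (hgmax p)
    have h₂ := smoothedProfit_add_le_of_isMaxOn hconvex hc (hgY q) (hgY p) (hgmax q)
    rw [norm_sub_rev (g q)] at h₂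
    have h₃ := real_inner_le_norm (g p - g q) (p - q)
    simp only [inner_sub_left, inner_sub_right] at h₃
    rw [one_div, inv_mul_eq_div, le_div_iff₀ hη]
    rcases (norm_nonneg (g p - g q)).eq_or_lt with h | h
    · rw [← h]; simp
    · refine le_of_mul_le_mul_left ?_ h
      nlinarith
  refine ⟨g, fun p => ?_, hlip⟩
  rw [hasGradientAt_iff_isLittleO]
  refine Asymptotics.IsBigO.trans_isLittleO (g := fun q => ‖q - p‖ ^ 2) ?_ ?_
  · refine Asymptotics.IsBigO.of_bound (1 / η) (Filter.Eventually.of_forall fun q => ?_)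
    have hlower : ⟪g p, q⟫ - c (g p) - η * ‖g p - y0‖ ^ 2 ≤
      ⟪g q, q⟫ - c (g q) - η * ‖g q - y0‖ ^ 2 := hgmax q (hgY p)
    have hupper : ⟪g q, p⟫ - c (g q) - η * ‖g q - y0‖ ^ 2 ≤
      ⟪g p, p⟫ - c (g p) - η * ‖g p - y0‖ ^ 2 := hgmax p (hgY q)
    have hcs := real_inner_le_norm (g q - g p) (q - p)
    have hmul := mul_le_mul_of_nonneg_right (hlip q p) (norm_nonneg (q - p))
    have hη' : 0 ≤ 1 / η * ‖q - p‖ ^ 2 := by positivity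
    simp only [inner_sub_left, inner_sub_right] at hcs
    rw [hval, hval, Real.norm_eq_abs, Real.norm_eq_abs, abs_of_nonneg (sq_nonneg ‖q - p‖),
      abs_le, inner_sub_right]
    constructor <;> nlinarith
  · refine Asymptotics.isLittleO_norm_right.1 ?_
    have : Filter.Tendsto (fun q => ‖q - p‖) (nhds p) (nhds 0) := by
      simpa using tendsto_norm_sub_self p
    exact (Asymptotics.isLittleO_pow_id one_lt_two).comp_tendsto this

/-- Shrinking the deviation of group means from the total mean decreases the weighted sum of
squared deviations, which is at most the weighted second moment. -/
theorem sum_mul_sub_groupMean_sq_le {ι κ : Type*} [Fintype ι] [Fintype κ] [DecidableEq κ]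
    (grp : ι → κ) (P v : ι → ℝ) (μ mean : κ → ℝ) (hP : ∀ k, 0 ≤ P k) (hP1 : ∑ k, P k = 1)
    (hμ0 : ∀ j, 0 < μ j) (hμ1 : ∀ j, μ j ≤ 1)
    (hmean : ∀ j, ∑ k with grp k = j, P k * v k = mean j * ∑ k with grp k = j, P k) :
    ∑ k, P k * (v k - (1 - μ (grp k)) * mean (grp k) - μ (grp k) * ∑ i, P i * v i) ^ 2 ≤
      ∑ k, P k * v k ^ 2 := by
  set M := ∑ i, P i * v i with hM
  have hcross : ∑ k, P k * (2 * (1 - μ (grp k)) * (mean (grp k) - M) *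
      (v k - mean (grp k))) = 0 := by
    rw [← Finset.sum_fiberwise _ grp]
    refine Finset.sum_eq_zero fun j _ => ?_
    calc ∑ k with grp k = j, P k * (2 * (1 - μ (grp k)) * (mean (grp k) - M) *
          (v k - mean (grp k)))
        = ∑ k with grp k = j, 2 * (1 - μ j) * (mean j - M) * (P k * v k - mean j * P k) := by
          refine Finset.sum_congr rfl fun k hk => ?_
          rw [(Finset.mem_filter.1 hk).2]; ring
      _ = 0 := by
          rw [← Finset.mul_sum, Finset.sum_sub_distrib, ← Finset.mul_sum, hmean, sub_self,
            mul_zero]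
  have hdev : ∑ k, P k * (v k - M) ^ 2 = ∑ k, P k * v k ^ 2 - M ^ 2 := by
    have : ∀ k, P k * (v k - M) ^ 2 = P k * v k ^ 2 - 2 * M * (P k * v k) + M ^ 2 * P k :=
      fun k => by ring
    simp only [this, Finset.sum_add_distrib, Finset.sum_sub_distrib, ← Finset.mul_sum, hP1, ← hM]
    ring
  calc ∑ k, P k * (v k - (1 - μ (grp k)) * mean (grp k) - μ (grp k) * M) ^ 2
      ≤ ∑ k, (P k * (v k - M) ^ 2 - P k * (2 * (1 - μ (grp k)) * (mean (grp k) - M) *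
          (v k - mean (grp k)))) := by
        refine Finset.sum_le_sum fun k _ => ?_
        have hμsq : 0 ≤ 1 - μ (grp k) ^ 2 := by nlinarith [hμ0 (grp k), hμ1 (grp k)]
        have := mul_nonneg (hP k) (mul_nonneg hμsq (sq_nonneg (mean (grp k) - M)))
        linarith
    _ ≤ ∑ k, P k * v k ^ 2 := by
        rw [Finset.sum_sub_distrib, hcross, hdev]
        nlinarith [sq_nonneg M]

section Surplus

variable {n m : ℕ} (grp : Fin n → Fin m) (a : Fin n → ℝ) (μ : Fin m → ℝ)

/-- The argument of the logarithm in `surplus`. -/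
noncomputable def inclusiveSum (p : EuclideanSpace ℝ (Fin n)) : ℝ :=
  ∑ h : Fin m, (groupSum grp a μ p h) ^ (μ h)

/-- The nested-logit mean of `v` within group `j`. -/
noncomputable def groupMean (p v : EuclideanSpace ℝ (Fin n)) (j : Fin m) : ℝ :=
  (∑ k with grp k = j, Real.exp ((a k - p k) / μ j) * v k) / groupSum grp a μ p j

/-- The nested-logit probability of choosing product `k`. -/
noncomputable def choiceProb (p : EuclideanSpace ℝ (Fin n)) (k : Fin n) : ℝ :=
  Real.exp ((a k - p k) / μ (grp k)) * groupSum grp a μ p (grp k) ^ (μ (grp k) - 1) /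
    inclusiveSum grp a μ p

variable {grp}

theorem groupSum_pos (hgrp : Function.Surjective grp) (p : EuclideanSpace ℝ (Fin n))
    (j : Fin m) : 0 < groupSum grp a μ p j := by
  obtain ⟨k, hk⟩ := hgrp j
  exact Finset.sum_pos (fun _ _ => Real.exp_pos _) ⟨k, by simp [hk]⟩

theorem inclusiveSum_pos (hm : 0 < m) (hgrp : Function.Surjective grp)
    (p : EuclideanSpace ℝ (Fin n)) : 0 < inclusiveSum grp a μ p :=
  Finset.sum_pos (fun j _ => Real.rpow_pos_of_pos (groupSum_pos a μ hgrp p j) _)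
    ⟨⟨0, hm⟩, Finset.mem_univ _⟩

theorem choiceProb_nonneg (hm : 0 < m) (hgrp : Function.Surjective grp)
    (p : EuclideanSpace ℝ (Fin n)) (k : Fin n) : 0 ≤ choiceProb grp a μ p k :=
  div_nonneg (mul_nonneg (Real.exp_pos _).le
    (Real.rpow_nonneg (groupSum_pos a μ hgrp p _).le _)) (inclusiveSum_pos a μ hm hgrp p).le

theorem sum_group_choiceProb (hgrp : Function.Surjective grp) (p : EuclideanSpace ℝ (Fin n))
    (j : Fin m) : ∑ k with grp k = j, choiceProb grp a μ p k =
      groupSum grp a μ p j ^ μ j / inclusiveSum grp a μ p := by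
  have hpos := groupSum_pos a μ hgrp p j
  calc ∑ k with grp k = j, choiceProb grp a μ p k
      = ∑ k with grp k = j, Real.exp ((a k - p k) / μ j) *
          (groupSum grp a μ p j ^ (μ j - 1) / inclusiveSum grp a μ p) := by
        refine Finset.sum_congr rfl fun k hk => ?_
        rw [choiceProb, (Finset.mem_filter.1 hk).2, mul_div_assoc]
    _ = groupSum grp a μ p j ^ μ j / inclusiveSum grp a μ p := by
        rw [← Finset.sum_mul, ← groupSum, Real.rpow_sub_one hpos.ne']
        field_simp

theorem sum_group_choiceProb_mul (hgrp : Function.Surjective grp)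
    (p v : EuclideanSpace ℝ (Fin n)) (j : Fin m) :
    ∑ k with grp k = j, choiceProb grp a μ p k * v k =
      groupMean grp a μ p v j * ∑ k with grp k = j, choiceProb grp a μ p k := by
  have hpos := groupSum_pos a μ hgrp p j
  calc ∑ k with grp k = j, choiceProb grp a μ p k * v k
      = ∑ k with grp k = j, Real.exp ((a k - p k) / μ j) * v k *
          (groupSum grp a μ p j ^ (μ j - 1) / inclusiveSum grp a μ p) := by
        refine Finset.sum_congr rfl fun k hk => ?_
        rw [choiceProb, (Finset.mem_filter.1 hk).2]; ring
    _ = _ := by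
        rw [← Finset.sum_mul, sum_group_choiceProb a μ hgrp, groupMean,
          Real.rpow_sub_one hpos.ne']
        field_simp

theorem sum_choiceProb (hm : 0 < m) (hgrp : Function.Surjective grp)
    (p : EuclideanSpace ℝ (Fin n)) : ∑ k, choiceProb grp a μ p k = 1 := by
  rw [← Finset.sum_fiberwise _ grp]
  simp only [sum_group_choiceProb a μ hgrp]
  rw [← Finset.sum_div, ← inclusiveSum, div_self (inclusiveSum_pos a μ hm hgrp p).ne']

theorem hasDerivAt_exp_line (p v : EuclideanSpace ℝ (Fin n)) (k : Fin n) (j : Fin m) (t : ℝ) :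
    HasDerivAt (fun t : ℝ => Real.exp ((a k - (p + t • v) k) / μ j))
      (-(Real.exp ((a k - (p + t • v) k) / μ j) * v k / μ j)) t := by
  have h : HasDerivAt (fun t : ℝ => (a k - (p + t • v) k) / μ j) (-(v k) / μ j) t := by
    simpa using ((((hasDerivAt_id t).mul_const (v k)).const_add (p k)).const_sub (a k)).div_const
      (μ j)
  refine h.exp.congr_deriv ?_
  ring

theorem hasDerivAt_groupSum_line (hgrp : Function.Surjective grp)
    (p v : EuclideanSpace ℝ (Fin n)) (j : Fin m) (t : ℝ) :
    HasDerivAt (fun t : ℝ => groupSum grp a μ (p + t • v) j)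
      (-(groupSum grp a μ (p + t • v) j * groupMean grp a μ (p + t • v) v j / μ j)) t := by
  have hpos := groupSum_pos a μ hgrp (p + t • v) j
  have h := HasDerivAt.fun_sum (u := Finset.univ.filter fun k => grp k = j)
    fun k _ => hasDerivAt_exp_line a μ p v k j t
  refine h.congr_deriv ?_
  rw [groupMean, Finset.sum_neg_distrib, ← Finset.sum_div, mul_div_cancel₀ _ hpos.ne']

theorem hasDerivAt_inclusiveSum_line (hm : 0 < m) (hgrp : Function.Surjective grp)
    (hμ0 : ∀ j, 0 < μ j) (p v : EuclideanSpace ℝ (Fin n)) (t : ℝ) :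
    HasDerivAt (fun t : ℝ => inclusiveSum grp a μ (p + t • v))
      (-(inclusiveSum grp a μ (p + t • v) * ∑ k, choiceProb grp a μ (p + t • v) k * v k)) t := by
  have hZ := inclusiveSum_pos a μ hm hgrp (p + t • v)
  have h := HasDerivAt.fun_sum (u := Finset.univ) fun j _ =>
    (hasDerivAt_groupSum_line a μ hgrp p v j t).rpow_const (p := μ j)
      (Or.inl (groupSum_pos a μ hgrp (p + t • v) j).ne')
  refine h.congr_deriv (Eq.symm ?_)
  rw [← Finset.sum_fiberwise _ grp, Finset.mul_sum, ← Finset.sum_neg_distrib]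
  refine Finset.sum_congr rfl fun j _ => ?_
  have hpos := groupSum_pos a μ hgrp (p + t • v) j
  have := hμ0 j
  rw [sum_group_choiceProb_mul a μ hgrp, sum_group_choiceProb a μ hgrp,
    Real.rpow_sub_one hpos.ne']
  field_simp

theorem hasDerivAt_surplus_line (hm : 0 < m) (hgrp : Function.Surjective grp)
    (hμ0 : ∀ j, 0 < μ j) (p v : EuclideanSpace ℝ (Fin n)) (t : ℝ) :
    HasDerivAt (fun t : ℝ => surplus grp a μ (p + t • v))
      (-∑ k, choiceProb grp a μ (p + t • v) k * v k) t := by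
  have hZ := inclusiveSum_pos a μ hm hgrp (p + t • v)
  refine ((hasDerivAt_inclusiveSum_line a μ hm hgrp hμ0 p v t).log hZ.ne').congr_deriv ?_
  field_simp

theorem hasDerivAt_choiceProb_line (hm : 0 < m) (hgrp : Function.Surjective grp)
    (hμ0 : ∀ j, 0 < μ j) (p v : EuclideanSpace ℝ (Fin n)) (k : Fin n) (t : ℝ) :
    HasDerivAt (fun t : ℝ => choiceProb grp a μ (p + t • v) k)
      (-(choiceProb grp a μ (p + t • v) k * ((v k -
        (1 - μ (grp k)) * groupMean grp a μ (p + t • v) v (grp k) -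
        μ (grp k) * ∑ i, choiceProb grp a μ (p + t • v) i * v i) / μ (grp k)))) t := by
  have hZ := inclusiveSum_pos a μ hm hgrp (p + t • v)
  have hpos := groupSum_pos a μ hgrp (p + t • v) (grp k)
  have := hμ0 (grp k)
  have h := ((hasDerivAt_exp_line a μ p v k (grp k) t).mul
    ((hasDerivAt_groupSum_line a μ hgrp p v (grp k) t).rpow_const (p := μ (grp k) - 1)
      (Or.inl hpos.ne'))).div (hasDerivAt_inclusiveSum_line a μ hm hgrp hμ0 p v t) hZ.ne'
  refine h.congr_deriv ?_
  simp only [Pi.mul_apply]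
  set M := ∑ i, choiceProb grp a μ (p + t • v) i * v i
  rw [choiceProb, Real.rpow_sub_one hpos.ne' (μ (grp k) - 1)]
  field_simp
  ring

theorem differentiable_surplus (hm : 0 < m) (hgrp : Function.Surjective grp) :
    Differentiable ℝ (surplus grp a μ) := by
  have hG (j) : Differentiable ℝ fun p => groupSum grp a μ p j := by
    unfold groupSum; fun_prop
  have hZ : Differentiable ℝ (inclusiveSum grp a μ) :=
    Differentiable.fun_sum fun j _ =>
      (hG j).rpow_const fun p => Or.inl (groupSum_pos a μ hgrp p j).ne'
  exact hZ.log fun p => (inclusiveSum_pos a μ hm hgrp p).ne'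

theorem hasGradientAt_surplus (hm : 0 < m) (hgrp : Function.Surjective grp)
    (hμ0 : ∀ j, 0 < μ j) (p : EuclideanSpace ℝ (Fin n)) :
    HasGradientAt (surplus grp a μ) (-WithLp.toLp 2 (choiceProb grp a μ p)) p := by
  have hdiff := differentiable_surplus a μ hm hgrp p
  convert hdiff.hasGradientAt using 1
  refine ext_inner_right ℝ fun v => ?_
  rw [inner_gradient_left]
  have hline : HasDerivAt (fun t : ℝ => surplus grp a μ (p + t • v))
      (fderiv ℝ (surplus grp a μ) p v) 0 := hdiff.hasFDerivAt.hasLineDerivAt v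
  have h := (hasDerivAt_surplus_line a μ hm hgrp hμ0 p v 0).unique hline
  rw [← h]
  simp [PiLp.inner_apply, mul_comm]

theorem norm_choiceProb_sub_le (hm : 0 < m) (hgrp : Function.Surjective grp)
    (hμ0 : ∀ j, 0 < μ j) (hμ1 : ∀ j, μ j ≤ 1) {δ : ℝ} (hδ : 0 < δ) (hδμ : ∀ j, δ ≤ μ j)
    (p q : EuclideanSpace ℝ (Fin n)) :
    ‖WithLp.toLp 2 (choiceProb grp a μ p) - WithLp.toLp 2 (choiceProb grp a μ q)‖ ≤
      1 / δ * ‖p - q‖ := by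
  set v := p - q with hv
  let x (t : ℝ) (k : Fin n) : ℝ := v k -
    (1 - μ (grp k)) * groupMean grp a μ (q + t • v) v (grp k) -
    μ (grp k) * ∑ i, choiceProb grp a μ (q + t • v) i * v i
  have hderiv (t : ℝ) : HasDerivAt
      (fun t : ℝ => WithLp.toLp 2 (choiceProb grp a μ (q + t • v)))
      (WithLp.toLp 2 fun k => -(choiceProb grp a μ (q + t • v) k * (x t k / μ (grp k)))) t :=
    HasFDerivAt.comp_hasDerivAt t
      (PiLp.continuousLinearEquiv 2 ℝ fun _ : Fin n => ℝ).symm.hasFDerivAt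
      (hasDerivAt_pi.2 fun k => hasDerivAt_choiceProb_line a μ hm hgrp hμ0 q v k t)
  have hbound (t : ℝ) :
      ‖WithLp.toLp 2 fun k => -(choiceProb grp a μ (q + t • v) k * (x t k / μ (grp k)))‖ ≤
        1 / δ * ‖v‖ := by
    have hP := choiceProb_nonneg a μ hm hgrp (q + t • v)
    have hP1 := sum_choiceProb a μ hm hgrp (q + t • v)
    have hPle (k) : choiceProb grp a μ (q + t • v) k ≤ 1 :=
      hP1 ▸ Finset.single_le_sum (fun i _ => hP i) (Finset.mem_univ k)
    refine le_of_sq_le_sq ?_ (by positivity)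
    rw [mul_pow, EuclideanSpace.real_norm_sq_eq, EuclideanSpace.real_norm_sq_eq]
    calc ∑ k, (-(choiceProb grp a μ (q + t • v) k * (x t k / μ (grp k)))) ^ 2
        ≤ ∑ k, (1 / δ) ^ 2 * (choiceProb grp a μ (q + t • v) k * x t k ^ 2) := by
          refine Finset.sum_le_sum fun k _ => ?_
          have h₁ : (1 / μ (grp k)) ^ 2 ≤ (1 / δ) ^ 2 :=
            pow_le_pow_left₀ (one_div_nonneg.2 (hμ0 _).le)
              (one_div_le_one_div_of_le hδ (hδμ _)) 2
          have h₂ : choiceProb grp a μ (q + t • v) k ^ 2 ≤ choiceProb grp a μ (q + t • v) k :=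
            pow_le_of_le_one (hP k) (hPle k) two_ne_zero
          calc _ = (1 / μ (grp k)) ^ 2 * (choiceProb grp a μ (q + t • v) k ^ 2 * x t k ^ 2) := by
                ring
            _ ≤ _ := by gcongr
      _ ≤ (1 / δ) ^ 2 * ∑ k, v k ^ 2 := by
          rw [← Finset.mul_sum]
          refine mul_le_mul_of_nonneg_left ?_ (sq_nonneg _)
          refine (sum_mul_sub_groupMean_sq_le grp _ v μ _ hP hP1 hμ0 hμ1
            (sum_group_choiceProb_mul a μ hgrp (q + t • v) v)).trans ?_
          exact Finset.sum_le_sum fun k _ => mul_le_of_le_one_left (sq_nonneg _) (hPle k)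
  have h := norm_image_sub_le_of_norm_deriv_le_segment_01'
    (fun t _ => (hderiv t).hasDerivWithinAt) (fun t _ => hbound t)
  simpa [hv] using h

end Surplus

/-- Smoothness of the smoothed total revenue: `f_η` is differentiable and `∇f_η` is Lipschitz
continuous w.r.t. the Euclidean norm with constant `L = S/η + D/(min_j μ_j)`. -/
theorem totalRevenueSmoothed_smooth {n m S D : ℕ} (hm : 0 < m)
    (Y : Fin S → Set (EuclideanSpace ℝ (Fin n)))
    (hYne : ∀ s, (Y s).Nonempty) (hYclosed : ∀ s, IsClosed (Y s))
    (hYconvex : ∀ s, Convex ℝ (Y s))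
    (c : Fin S → EuclideanSpace ℝ (Fin n) → ℝ)
    (hc : ∀ s, ConvexOn ℝ Set.univ (c s)) (hccont : ∀ s, Continuous (c s))
    (η : ℝ) (hη : 0 < η) (y0 : EuclideanSpace ℝ (Fin n))
    (grp : Fin n → Fin m) (hgrp : Function.Surjective grp)
    (a : Fin n → Fin D → ℝ)
    (μ : Fin m → ℝ) (hμ0 : ∀ j, 0 < μ j) (hμ1 : ∀ j, μ j ≤ 1) :
    Differentiable ℝ (totalRevenueSmoothed Y c η y0 grp a μ) ∧
    ∀ p q : EuclideanSpace ℝ (Fin n),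
      ‖gradient (totalRevenueSmoothed Y c η y0 grp a μ) p -
          gradient (totalRevenueSmoothed Y c η y0 grp a μ) q‖ ≤
        ((S : ℝ) / η +
          (D : ℝ) / Finset.univ.inf' ⟨⟨0, hm⟩, Finset.mem_univ _⟩ μ) * ‖p - q‖ := by
  have hpos : 0 < Finset.univ.inf' ⟨⟨0, hm⟩, Finset.mem_univ _⟩ μ :=
    (Finset.lt_inf'_iff _).2 fun j _ => hμ0 j
  have hle (j) : Finset.univ.inf' ⟨⟨0, hm⟩, Finset.mem_univ _⟩ μ ≤ μ j :=
    Finset.inf'_le _ (Finset.mem_univ j)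
  set δ := Finset.univ.inf' ⟨⟨0, hm⟩, Finset.mem_univ _⟩ μ
  choose g hg hglip using fun s => exists_hasGradientAt_maxRevenueSmoothed (hYne s) (hYclosed s)
    (hYconvex s) (hc s) (hccont s) hη y0
  let P (d : Fin D) (p : EuclideanSpace ℝ (Fin n)) : EuclideanSpace ℝ (Fin n) :=
    WithLp.toLp 2 (choiceProb grp (fun i => a i d) μ p)
  have hgrad (p) : HasGradientAt (totalRevenueSmoothed Y c η y0 grp a μ)
      (∑ s, g s p + ∑ d, -P d p) p := by
    rw [hasGradientAt_iff_hasFDerivAt, map_add, map_sum, map_sum]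
    exact (HasFDerivAt.fun_sum fun s _ => (hg s p).hasFDerivAt).add
      (HasFDerivAt.fun_sum fun d _ =>
        (hasGradientAt_surplus (fun i => a i d) μ hm hgrp hμ0 p).hasFDerivAt)
  refine ⟨fun p => (hgrad p).differentiableAt, fun p q => ?_⟩
  rw [(hgrad p).gradient, (hgrad q).gradient, add_sub_add_comm, ← Finset.sum_sub_distrib,
    ← Finset.sum_sub_distrib, add_mul]
  refine (norm_add_le _ _).trans (add_le_add ?_ ?_)
  · refine (norm_sum_le_of_le _ fun s _ => hglip s p q).trans_eq ?_
    simp only [Finset.sum_const, Finset.card_univ, Fintype.card_fin, nsmul_eq_mul]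
    ring
  · refine (norm_sum_le_of_le _ fun d _ => ?_).trans_eq
      (b := ∑ _d : Fin D, 1 / δ * ‖p - q‖) ?_
    · rw [neg_sub_neg, norm_sub_rev]
      exact norm_choiceProb_sub_le (fun i => a i d) μ hm hgrp hμ0 hμ1 hpos hle p q
    · simp only [Finset.sum_const, Finset.card_univ, Fintype.card_fin, nsmul_eq_mul]
      ring
end

section
/- Convexity of the total expected revenue: f(p) = ∑_{s=1}^S π_s(p) + ∑_{d=1}^D E_d(p) is convex on ℝ^n, where π_s(p) = max_{y∈Y_s}{⟨y,p⟩ − c_s(y) − Γ_s‖y − ŷ_s‖₂²} with Γ_s ≥ 0, Y_s ⊆ ℝ^n nonempty compact convex, c_s convex continuous, ŷ_s ∈ Y_s, and E_d(p) = ln(∑_{j=1}^m (∑_{i∈G_j} e^{(a_{id}−p_i)/μ_j})^{μ_j}) with 0 < μ_j ≤ 1; consequently the dynamic-pricing problem min_{p∈ℝ^n_+} f(p) is a convex optimization problem. -/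
open Finset
open scoped RealInnerProductSpace

/-- A finite sum of convex functions is convex. -/
theorem convexOn_finset_sum {ι E : Type*} [AddCommGroup E] [Module ℝ E] {A : Set E}
    (hA : Convex ℝ A) (s : Finset ι) {u : ι → E → ℝ} (hu : ∀ i ∈ s, ConvexOn ℝ A (u i)) :
    ConvexOn ℝ A (fun x => ∑ i ∈ s, u i x) := by
  refine ⟨hA, fun x hx y hy α β hα hβ hαβ => ?_⟩
  simp only [Finset.smul_sum, ← Finset.sum_add_distrib]
  exact Finset.sum_le_sum fun i hi => (hu i hi).2 hx hy hα hβ hαβ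

/-- The log-sum-exp of finitely many convex functions is convex. -/
theorem convexOn_log_sum_exp {ι E : Type*} [AddCommGroup E] [Module ℝ E] {A : Set E}
    (hA : Convex ℝ A) (s : Finset ι) {u : ι → E → ℝ} (hu : ∀ i ∈ s, ConvexOn ℝ A (u i)) :
    ConvexOn ℝ A (fun x => Real.log (∑ i ∈ s, Real.exp (u i x))) := by
  rcases s.eq_empty_or_nonempty with rfl | hs
  · simpa using convexOn_const (0 : ℝ) hA
  refine ⟨hA, fun x hx y hy α β hα hβ hαβ => ?_⟩
  have hpos (z : E) : 0 < ∑ i ∈ s, Real.exp (u i z) :=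
    Finset.sum_pos (fun i _ => Real.exp_pos _) hs
  set L : E → ℝ := fun z => Real.log (∑ i ∈ s, Real.exp (u i z)) with hL
  have hnorm (z : E) : ∑ i ∈ s, Real.exp (u i z - L z) = 1 := by
    simp only [Real.exp_sub, ← Finset.sum_div]
    rw [hL, Real.exp_log (hpos z), div_self (hpos z).ne']
  have hterm (i : ι) (hi : i ∈ s) : Real.exp (u i (α • x + β • y)) ≤
      Real.exp (α • L x + β • L y) *
        (α * Real.exp (u i x - L x) + β * Real.exp (u i y - L y)) := by
    have hconv := (hu i hi).2 hx hy hα hβ hαβ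
    have hexp := convexOn_exp.2 (Set.mem_univ (u i x - L x)) (Set.mem_univ (u i y - L y))
      hα hβ hαβ
    simp only [smul_eq_mul] at hconv hexp ⊢
    calc Real.exp (u i (α • x + β • y))
        ≤ Real.exp (α * L x + β * L y + (α * (u i x - L x) + β * (u i y - L y))) :=
          Real.exp_le_exp.2 (by linarith)
      _ = Real.exp (α * L x + β * L y) *
            Real.exp (α * (u i x - L x) + β * (u i y - L y)) := Real.exp_add _ _
      _ ≤ _ := mul_le_mul_of_nonneg_left hexp (Real.exp_pos _).le
  refine (Real.log_le_iff_le_exp (hpos _)).2 ((Finset.sum_le_sum hterm).trans_eq ?_)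
  rw [← Finset.mul_sum, Finset.sum_add_distrib, ← Finset.mul_sum, ← Finset.mul_sum,
    hnorm, hnorm, mul_one, mul_one, hαβ, mul_one]

/-- The maximal revenue over a nonempty compact set is convex in the price. -/
theorem convexOn_maxRevenue {n : ℕ} {Y : Set (EuclideanSpace ℝ (Fin n))}
    (hne : Y.Nonempty) (hcompact : IsCompact Y) {c : EuclideanSpace ℝ (Fin n) → ℝ}
    (hc : Continuous c) (Γ : ℝ) (yhat : EuclideanSpace ℝ (Fin n)) :
    ConvexOn ℝ Set.univ (maxRevenue Y c Γ yhat) := by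
  have hle (p y : EuclideanSpace ℝ (Fin n)) (hy : y ∈ Y) :
      revenueObj c Γ yhat p y ≤ maxRevenue Y c Γ yhat p := by
    refine le_csSup (hcompact.bddAbove_image ?_) (Set.mem_image_of_mem _ hy)
    unfold revenueObj
    fun_prop
  refine ⟨convex_univ, fun p _ q _ α β hα hβ hαβ => csSup_le (hne.image _) ?_⟩
  rintro _ ⟨y, hy, rfl⟩
  calc revenueObj c Γ yhat (α • p + β • q) y
      = α * revenueObj c Γ yhat p y + β * revenueObj c Γ yhat q y := by
        simp only [revenueObj, inner_add_right, real_inner_smul_right]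
        linear_combination (c y + Γ * ‖y - yhat‖ ^ 2) * hαβ
    _ ≤ _ := add_le_add (mul_le_mul_of_nonneg_left (hle p y hy) hα)
        (mul_le_mul_of_nonneg_left (hle q y hy) hβ)

/-- The expected consumer surplus is convex in the price. -/
theorem convexOn_surplus {n m : ℕ} {grp : Fin n → Fin m} (hgrp : Function.Surjective grp)
    (a : Fin n → ℝ) {μ : Fin m → ℝ} (hμ : ∀ j, 0 < μ j) :
    ConvexOn ℝ Set.univ (surplus grp a μ) := by
  have hpos (p : EuclideanSpace ℝ (Fin n)) (j : Fin m) : 0 < groupSum grp a μ p j := by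
    obtain ⟨k, hk⟩ := hgrp j
    exact Finset.sum_pos (fun i _ => Real.exp_pos _) ⟨k, by simp [hk]⟩
  have hgroup (j : Fin m) :
      ConvexOn ℝ Set.univ (fun p => μ j • Real.log (groupSum grp a μ p j)) := by
    refine (convexOn_log_sum_exp convex_univ _ fun k _ => ?_).smul (hμ j).le
    refine ⟨convex_univ, fun p _ q _ α β _ _ hαβ => le_of_eq ?_⟩
    simp only [PiLp.add_apply, PiLp.smul_apply, smul_eq_mul]
    linear_combination -(a k / μ j) * hαβ
  refine (convexOn_log_sum_exp convex_univ Finset.univ fun j _ => hgroup j).congr fun p _ => ?_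
  simp only [surplus, smul_eq_mul]
  refine congrArg Real.log (Finset.sum_congr rfl fun j _ => ?_)
  rw [Real.rpow_def_of_pos (hpos p j), mul_comm]

/-- Convexity of the total expected revenue: `f(p) = ∑_s π_s(p) + ∑_d E_d(p)` is convex on
`ℝ^n`; consequently the dynamic-pricing problem `min_{p∈ℝ^n_+} f(p)` is a convex optimization
problem (the feasible set `ℝ^n_+` is convex and `f` is convex on it). -/
theorem totalRevenue_convex {n m S D : ℕ}
    (Y : Fin S → Set (EuclideanSpace ℝ (Fin n)))
    (hYne : ∀ s, (Y s).Nonempty) (hYcompact : ∀ s, IsCompact (Y s))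
    (hYconvex : ∀ s, Convex ℝ (Y s))
    (c : Fin S → EuclideanSpace ℝ (Fin n) → ℝ)
    (hc : ∀ s, ConvexOn ℝ Set.univ (c s)) (hccont : ∀ s, Continuous (c s))
    (Γ : Fin S → ℝ) (hΓ : ∀ s, 0 ≤ Γ s)
    (yhat : Fin S → EuclideanSpace ℝ (Fin n)) (hyhat : ∀ s, yhat s ∈ Y s)
    (grp : Fin n → Fin m) (hgrp : Function.Surjective grp)
    (a : Fin n → Fin D → ℝ)
    (μ : Fin m → ℝ) (hμ0 : ∀ j, 0 < μ j) (hμ1 : ∀ j, μ j ≤ 1) :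
    ConvexOn ℝ Set.univ (totalRevenue Y c Γ yhat grp a μ) ∧
    Convex ℝ {p : EuclideanSpace ℝ (Fin n) | ∀ i, 0 ≤ p i} ∧
    ConvexOn ℝ {p : EuclideanSpace ℝ (Fin n) | ∀ i, 0 ≤ p i}
      (totalRevenue Y c Γ yhat grp a μ) := by
  have hconv : ConvexOn ℝ Set.univ (totalRevenue Y c Γ yhat grp a μ) :=
    (convexOn_finset_sum convex_univ Finset.univ fun s _ =>
      convexOn_maxRevenue (hYne s) (hYcompact s) (hccont s) (Γ s) (yhat s)).add
    (convexOn_finset_sum convex_univ Finset.univ fun d _ =>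
      convexOn_surplus hgrp (fun i => a i d) hμ0)
  have horthant : Convex ℝ {p : EuclideanSpace ℝ (Fin n) | ∀ i, 0 ≤ p i} := by
    intro p hp q hq α β hα hβ _ i
    exact add_nonneg (mul_nonneg hα (hp i)) (mul_nonneg hβ (hq i))
  exact ⟨hconv, horthant, hconv.subset (Set.subset_univ _) horthant⟩
end
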